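/- arXiv:1203.4935 — 7 statements merged into one kernel-verified Lean document; each statement's English description precedes it below -/
import Mathlib

section
/- For every a > 0, c > 0, and every θ ∈ ℝ^p with |θ| < c, the acceptance region of the usual procedure is contained in that of the recentered positive-part procedure: {x ∈ ℝ^p : |x − θ| ≤ c} ⊆ {x ∈ ℝ^p : |δ⁺_a(x) − θ| ≤ c}. -/
open MeasureTheory ProbabilityTheory

/-- Euclidean norm on `Fin p → ℝ`. -/
noncomputable def euclNorm {p : ℕ} (x : Fin p → ℝ) : ℝ := Real.sqrt (∑ i, (x i) ^ 2)

/-- Positive-part James–Stein estimator `δ⁺_a(x) = max(0, 1 - a/|x|²) • x`, with value `0` at `0`. -/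
noncomputable def jsPlus {p : ℕ} (a : ℝ) (x : Fin p → ℝ) : Fin p → ℝ :=
  if x = 0 then 0 else (max 0 (1 - a / (euclNorm x) ^ 2)) • x

/-- For `|θ| < c`, the acceptance region of the usual procedure is contained in that of the
recentered positive-part procedure. -/
theorem stmt0 (p : ℕ) (hp : 1 ≤ p) (a c : ℝ) (ha : 0 < a) (hc : 0 < c)
    (θ : Fin p → ℝ) (hθ : euclNorm θ < c) :
    {x : Fin p → ℝ | euclNorm (x - θ) ≤ c} ⊆
      {x : Fin p → ℝ | euclNorm (jsPlus a x - θ) ≤ c} := by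
  intro x hx
  simp only [Set.mem_setOf_eq] at hx ⊢
  have key : ∀ y : Fin p → ℝ, euclNorm y ≤ c ↔ ∑ i, (y i) ^ 2 ≤ c ^ 2 := by
    intro y
    unfold euclNorm
    exact Real.sqrt_le_left hc.le
  have hθ' := (key θ).1 hθ.le
  rw [key] at hx ⊢
  obtain ⟨t, h0, h1, ht⟩ : ∃ t : ℝ, 0 ≤ t ∧ t ≤ 1 ∧ jsPlus a x = t • x := by
    unfold jsPlus
    split_ifs with h
    · exact ⟨0, le_rfl, zero_le_one, by simp⟩
    · refine ⟨_, le_max_left _ _, max_le zero_le_one ?_, rfl⟩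
      have : 0 ≤ a / euclNorm x ^ 2 := by positivity
      linarith
  rw [ht]
  calc ∑ i, ((t • x - θ) i) ^ 2
      ≤ ∑ i, (t * ((x - θ) i) ^ 2 + (1 - t) * (θ i) ^ 2) := by
        apply Finset.sum_le_sum
        intro i _
        simp only [Pi.sub_apply, Pi.smul_apply, smul_eq_mul]
        have : 0 ≤ t * (1 - t) * (x i) ^ 2 :=
          mul_nonneg (mul_nonneg h0 (by linarith)) (sq_nonneg _)
        nlinarith
    _ = t * ∑ i, ((x - θ) i) ^ 2 + (1 - t) * ∑ i, (θ i) ^ 2 := by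
        rw [Finset.sum_add_distrib, Finset.mul_sum, Finset.mul_sum]
    _ ≤ t * c ^ 2 + (1 - t) * c ^ 2 := by
        have : 0 ≤ 1 - t := by linarith
        gcongr
    _ = c ^ 2 := by ring
end

section
/- Let X have the p-variate normal distribution N(θ, I_p). For every a > 0, c > 0, and every θ ∈ ℝ^p with |θ| < c, P_θ({x : |θ − δ⁺_a(x)| ≤ c}) ≥ P_θ({x : |θ − x| ≤ c}). -/
open MeasureTheory ProbabilityTheory

/-- The `p`-variate normal distribution `N(θ, I_p)`: the product measure whose `i`-th
coordinate is the one-dimensional Gaussian `N(θ i, 1)`. -/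
noncomputable def gaussPi (p : ℕ) (θ : Fin p → ℝ) : Measure (Fin p → ℝ) :=
  Measure.pi fun i => gaussianReal (θ i) 1


lemma euclNorm_eq_norm {p : ℕ} (x : Fin p → ℝ) :
    euclNorm x = ‖(WithLp.toLp 2 x : EuclideanSpace ℝ (Fin p))‖ := by
  rw [EuclideanSpace.norm_eq]
  simp [euclNorm]

lemma jsPlus_eq_smul {p : ℕ} (a : ℝ) (ha : 0 < a) (x : Fin p → ℝ) :
    ∃ t : ℝ, 0 ≤ t ∧ t ≤ 1 ∧ jsPlus a x = t • x := by
  by_cases hx : x = 0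
  · exact ⟨0, le_refl _, zero_le_one, by simp [jsPlus, hx]⟩
  · refine ⟨max 0 (1 - a / (euclNorm x) ^ 2), le_max_left _ _, ?_, by simp [jsPlus, hx]⟩
    have : 0 ≤ a / (euclNorm x) ^ 2 := by positivity
    exact max_le zero_le_one (by linarith)

/-- For `|θ| < c`, the recentered positive-part set has coverage probability at least that of
the usual confidence set. -/
theorem stmt1 (p : ℕ) (hp : 1 ≤ p) (a c : ℝ) (ha : 0 < a) (hc : 0 < c)
    (θ : Fin p → ℝ) (hθ : euclNorm θ < c) :
    gaussPi p θ {x : Fin p → ℝ | euclNorm (θ - jsPlus a x) ≤ c} ≥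
      gaussPi p θ {x : Fin p → ℝ | euclNorm (θ - x) ≤ c} := by
  refine measure_mono ?_
  intro x hx
  simp only [Set.mem_setOf_eq] at hx ⊢
  obtain ⟨t, h0, h1, ht⟩ := jsPlus_eq_smul a ha x
  have key : θ - jsPlus a x = (1 - t) • θ + t • (θ - x) := by
    rw [ht]; ext i; simp; ring
  rw [key, euclNorm_eq_norm, WithLp.toLp_add, WithLp.toLp_smul, WithLp.toLp_smul]
  rw [euclNorm_eq_norm] at hx hθ
  refine (norm_add_le _ _).trans ?_
  rw [norm_smul, norm_smul, Real.norm_of_nonneg h0, Real.norm_of_nonneg (by linarith : 0 ≤ 1 - t)]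
  nlinarith [mul_le_mul_of_nonneg_left hx h0,
    mul_le_mul_of_nonneg_left hθ.le (by linarith : 0 ≤ 1 - t)]
end

section
/- Let p ≥ 3 and 0 < a < 2(p − 2). Then for every θ ∈ ℝ^p, E_θ|δ^JS_a(X) − θ|² ≤ E_θ|X − θ|², and there exists θ for which the inequality is strict, where X ~ N(θ, I_p). -/
open MeasureTheory ProbabilityTheory

/-- James–Stein estimator `δ^JS_a(x) = (1 - a/|x|²) • x`, with value `0` at `0`. -/
noncomputable def jsEst {p : ℕ} (a : ℝ) (x : Fin p → ℝ) : Fin p → ℝ :=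
  if x = 0 then 0 else (1 - a / (euclNorm x) ^ 2) • x

lemma gpdf_deriv (m t : ℝ) :
    HasDerivAt (gaussianPDFReal m 1) (-((t - m) * gaussianPDFReal m 1 t)) t := by
  have h1 : HasDerivAt (fun t : ℝ => -(t - m) ^ 2 / (2 * ((1 : NNReal) : ℝ))) (-(t - m)) t := by
    have := ((((hasDerivAt_id t).sub_const m).pow 2).neg).div_const (2 * ((1 : NNReal) : ℝ))
    refine HasDerivAt.congr_deriv this ?_
    simp
    ring
  have h2 := (h1.exp).const_mul ((Real.sqrt (2 * Real.pi * ((1 : NNReal) : ℝ)))⁻¹)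
  rw [gaussianPDFReal_def]
  refine HasDerivAt.congr_deriv h2 ?_
  ring

lemma kbound (t K : ℝ) (hK : 0 < K) : |t / (t ^ 2 + K)| ≤ 1 / K + 1 := by
  have hp : 0 < t ^ 2 + K := by positivity
  rw [abs_div, abs_of_pos hp, div_le_iff₀ hp]
  have : (1 / K + 1) * (t ^ 2 + K) = t ^ 2 / K + 1 + t ^ 2 + K := by field_simp; ring
  rw [this]
  have : 0 ≤ t ^ 2 / K := by positivity
  nlinarith [sq_abs t, sq_nonneg (|t| - 1), abs_nonneg t]

lemma kbound2 (t K : ℝ) (hK : 0 < K) :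
    |1 / (t ^ 2 + K) - 2 * t ^ 2 / (t ^ 2 + K) ^ 2| ≤ 1 / K := by
  have hp : 0 < t ^ 2 + K := by positivity
  have e : 1 / (t ^ 2 + K) - 2 * t ^ 2 / (t ^ 2 + K) ^ 2
      = 1 / (t ^ 2 + K) * ((K - t ^ 2) / (t ^ 2 + K)) := by
    field_simp; ring
  rw [e, abs_mul]
  have h1 : |1 / (t ^ 2 + K)| ≤ 1 / K := by
    rw [abs_of_pos (by positivity)]
    exact one_div_le_one_div_of_le hK (by nlinarith [sq_nonneg t])
  have h2 : |(K - t ^ 2) / (t ^ 2 + K)| ≤ 1 := by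
    rw [abs_div, abs_of_pos hp, div_le_one hp, abs_le]
    constructor <;> nlinarith [sq_nonneg t]
  calc _ ≤ 1 / K * 1 := mul_le_mul h1 h2 (abs_nonneg _) (by positivity)
    _ = _ := mul_one _

lemma gauss_int_sub (m : ℝ) : Integrable (fun t => t - m) (gaussianReal m 1) := by
  have := (memLp_id_gaussianReal (μ := m) (v := 1) 1).integrable (by simp)
  exact this.sub (integrable_const m)

lemma gauss_int_sub_sq (m : ℝ) : Integrable (fun t => (t - m) ^ 2) (gaussianReal m 1) := by
  have := (memLp_id_gaussianReal (μ := m) (v := 1) 2)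
  exact (this.sub (memLp_const m)).integrable_sq

lemma stein1 (m K : ℝ) (hK : 0 < K) :
    ∫ t, ((t - m) * (t / (t ^ 2 + K)) - (1 / (t ^ 2 + K) - 2 * t ^ 2 / (t ^ 2 + K) ^ 2))
      ∂(gaussianReal m 1) = 0 := by
  have hpos : ∀ t : ℝ, t ^ 2 + K ≠ 0 := fun t => by positivity
  have c1 : Continuous fun t : ℝ => t / (t ^ 2 + K) := by fun_prop (disch := exact hpos _)
  have c2 : Continuous fun t : ℝ => 1 / (t ^ 2 + K) - 2 * t ^ 2 / (t ^ 2 + K) ^ 2 := by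
    have : ∀ t : ℝ, (t ^ 2 + K) ^ 2 ≠ 0 := fun t => pow_ne_zero _ (hpos t)
    fun_prop (disch := first | exact hpos _ | exact this _)
  have i0 : Integrable (gaussianPDFReal m 1) := integrable_gaussianPDFReal m 1
  have i1 : Integrable (fun t => (t - m) * gaussianPDFReal m 1 t) := by
    have := gauss_int_sub m
    rw [gaussianReal_of_var_ne_zero _ one_ne_zero,
      integrable_withDensity_iff (measurable_gaussianPDF _ _)
        (Filter.Eventually.of_forall fun _ => gaussianPDF_lt_top)] at this
    simpa [toReal_gaussianPDF] using this
  have hv : ∀ t : ℝ, HasDerivAt (fun t : ℝ => t / (t ^ 2 + K))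
      (1 / (t ^ 2 + K) - 2 * t ^ 2 / (t ^ 2 + K) ^ 2) t := by
    intro t
    have h := (hasDerivAt_id t).div (((hasDerivAt_id t).pow 2).add_const K) (hpos t)
    refine HasDerivAt.congr_deriv h ?_
    have := hpos t
    simp
    field_simp
  have b1 : Integrable (fun t => gaussianPDFReal m 1 t *
      (1 / (t ^ 2 + K) - 2 * t ^ 2 / (t ^ 2 + K) ^ 2)) :=
    i0.mul_bdd (c := 1 / K) c2.aestronglyMeasurable
      (Filter.Eventually.of_forall fun t => kbound2 t K hK)
  have b2 : Integrable (fun t => -((t - m) * gaussianPDFReal m 1 t) * (t / (t ^ 2 + K))) :=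
    i1.neg.mul_bdd (c := 1 / K + 1) c1.aestronglyMeasurable
      (Filter.Eventually.of_forall fun t => kbound t K hK)
  have b3 : Integrable (fun t => gaussianPDFReal m 1 t * (t / (t ^ 2 + K))) :=
    i0.mul_bdd (c := 1 / K + 1) c1.aestronglyMeasurable
      (Filter.Eventually.of_forall fun t => kbound t K hK)
  have key := integral_mul_deriv_eq_deriv_mul_of_integrable
    (fun t _ => gpdf_deriv m t) (fun t _ => hv t) b1 b2 b3
  rw [integral_gaussianReal_eq_integral_smul one_ne_zero]
  have e : ∀ t, gaussianPDFReal m 1 t • ((t - m) * (t / (t ^ 2 + K)) -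
      (1 / (t ^ 2 + K) - 2 * t ^ 2 / (t ^ 2 + K) ^ 2)) =
      -(-((t - m) * gaussianPDFReal m 1 t) * (t / (t ^ 2 + K))) - gaussianPDFReal m 1 t *
      (1 / (t ^ 2 + K) - 2 * t ^ 2 / (t ^ 2 + K) ^ 2) := fun t => by
    simp only [smul_eq_mul]; ring
  simp_rw [e]
  have b2n : Integrable (fun t => -(-((t - m) * gaussianPDFReal m 1 t) * (t / (t ^ 2 + K)))) :=
    b2.neg
  rw [integral_sub b2n b1, integral_neg, key]
  simp

instance gaussPi_prob (p : ℕ) (θ : Fin p → ℝ) : IsProbabilityMeasure (gaussPi p θ) := by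
  unfold gaussPi; infer_instance

/-- squared norm -/
noncomputable def sqn {p : ℕ} (x : Fin p → ℝ) : ℝ := ∑ i, (x i) ^ 2

lemma sqn_nonneg {p : ℕ} (x : Fin p → ℝ) : 0 ≤ sqn x := Finset.sum_nonneg fun _ _ => sq_nonneg _

lemma sqn_meas {p : ℕ} : Measurable (sqn : (Fin p → ℝ) → ℝ) := by unfold sqn; fun_prop

lemma sqn_split {p : ℕ} (x : Fin p → ℝ) (i : Fin p) : 
    ∃ c, 0 ≤ c ∧ sqn x = (x i) ^ 2 + c :=
  ⟨∑ j ∈ Finset.univ.erase i, (x j) ^ 2, Finset.sum_nonneg fun _ _ => sq_nonneg _,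
    (Finset.add_sum_erase _ _ (Finset.mem_univ i)).symm⟩

lemma int_A {p : ℕ} (θ : Fin p → ℝ) (i : Fin p) (ε : ℝ) (hε : 0 < ε) :
    Integrable (fun x => (x i - θ i) * (x i / (sqn x + ε))) (gaussPi p θ) := by
  have h1 : Integrable (fun x : Fin p → ℝ => x i - θ i) (gaussPi p θ) :=
    integrable_comp_eval (μ := fun i => gaussianReal (θ i) 1) (gauss_int_sub (θ i))
  have := sqn_meas (p := p)
  refine h1.mul_bdd (c := 1 / ε + 1) (Measurable.aestronglyMeasurable (by fun_prop))
    (Filter.Eventually.of_forall fun x => ?_)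
  obtain ⟨c, hc, h⟩ := sqn_split x i
  rw [h, add_assoc]
  refine (kbound (x i) (c + ε) (by positivity)).trans ?_
  gcongr
  linarith

lemma int_B {p : ℕ} (θ : Fin p → ℝ) (i : Fin p) (ε : ℝ) (hε : 0 < ε) :
    Integrable (fun x => 1 / (sqn x + ε) - 2 * (x i) ^ 2 / (sqn x + ε) ^ 2) (gaussPi p θ) := by
  have := sqn_meas (p := p)
  refine Integrable.of_bound (C := 1 / ε) (Measurable.aestronglyMeasurable (by fun_prop))
    (Filter.Eventually.of_forall fun x => ?_)
  obtain ⟨c, hc, h⟩ := sqn_split x i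
  rw [h, add_assoc]
  refine (kbound2 (x i) (c + ε) (by positivity)).trans ?_
  gcongr
  linarith

lemma stein_coord {p : ℕ} (θ : Fin p → ℝ) (i : Fin p) (ε : ℝ) (hε : 0 < ε) :
    ∫ x, (x i - θ i) * (x i / (sqn x + ε)) ∂(gaussPi p θ) =
    ∫ x, (1 / (sqn x + ε) - 2 * (x i) ^ 2 / (sqn x + ε) ^ 2) ∂(gaussPi p θ) := by
  rw [← sub_eq_zero, ← integral_sub (int_A θ i ε hε) (int_B θ i ε hε)]
  have hI := (int_A θ i ε hε).sub (int_B θ i ε hε)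
  obtain _ | n := p
  · exact i.elim0
  have mp := (measurePreserving_piFinSuccAbove (fun i => gaussianReal (θ i) 1) i).symm
  unfold gaussPi at hI ⊢
  rw [← mp.integral_comp']
  have hI2 := mp.integrable_comp_of_integrable hI
  refine (integral_prod_symm _ hI2).trans ?_
  refine integral_eq_zero_of_ae (Filter.Eventually.of_forall fun y => ?_)
  have := stein1 (θ i) ((∑ j, (y j) ^ 2) + ε)
    (add_pos_of_nonneg_of_pos (Finset.sum_nonneg fun _ _ => sq_nonneg _) hε)
  simpa [MeasurableEquiv.piFinSuccAbove_symm_apply, Fin.insertNthEquiv, sqn,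
    Fin.sum_univ_succAbove _ i, add_assoc] using this

lemma int_C {p : ℕ} (θ : Fin p → ℝ) (ε : ℝ) (hε : 0 < ε) :
    Integrable (fun x => 1 / (sqn x + ε)) (gaussPi p θ) := by
  have := sqn_meas (p := p)
  refine Integrable.of_bound (C := 1 / ε) (Measurable.aestronglyMeasurable (by fun_prop))
    (Filter.Eventually.of_forall fun x => ?_)
  have := sqn_nonneg x
  rw [Real.norm_of_nonneg (by positivity)]
  gcongr
  linarith

/-- The cross term. -/
noncomputable def crs {p : ℕ} (θ x : Fin p → ℝ) : ℝ := ∑ i, (x i - θ i) * x i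

lemma int_D {p : ℕ} (θ : Fin p → ℝ) (ε : ℝ) (hε : 0 < ε) :
    Integrable (fun x => crs θ x / (sqn x + ε)) (gaussPi p θ) := by
  have := integrable_finsetSum Finset.univ (fun i _ => int_A θ i ε hε)
  refine this.congr (Filter.Eventually.of_forall fun x => ?_)
  simp only [crs, Finset.sum_div, mul_div_assoc]

lemma stein_ineq {p : ℕ} (θ : Fin p → ℝ) (ε : ℝ) (hε : 0 < ε) :
    ((p : ℝ) - 2) * ∫ x, 1 / (sqn x + ε) ∂(gaussPi p θ) ≤
      ∫ x, crs θ x / (sqn x + ε) ∂(gaussPi p θ) := by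
  have h1 : ∫ x, crs θ x / (sqn x + ε) ∂(gaussPi p θ) =
      ∫ x, ∑ i, (1 / (sqn x + ε) - 2 * (x i) ^ 2 / (sqn x + ε) ^ 2) ∂(gaussPi p θ) := by
    rw [integral_finsetSum _ (fun i _ => int_B θ i ε hε)]
    simp_rw [← stein_coord θ _ ε hε]
    rw [← integral_finsetSum _ (fun i _ => int_A θ i ε hε)]
    simp only [crs, Finset.sum_div, mul_div_assoc]
  rw [h1, ← integral_const_mul]
  refine integral_mono ((int_C θ ε hε).const_mul _)
    (integrable_finsetSum _ (fun i _ => int_B θ i ε hε)) fun x => ?_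
  have hs := sqn_nonneg x
  have e : ∑ i, (1 / (sqn x + ε) - 2 * (x i) ^ 2 / (sqn x + ε) ^ 2)
      = p * (1 / (sqn x + ε)) - 2 * sqn x / (sqn x + ε) ^ 2 := by
    rw [Finset.sum_sub_distrib, ← Finset.sum_div _ (fun i => 2 * (x i) ^ 2), ← Finset.mul_sum]
    simp [sqn]
  simp only [e]
  have : sqn x / (sqn x + ε) ^ 2 ≤ 1 / (sqn x + ε) := by
    rw [div_le_div_iff₀ (by positivity) (by positivity)]
    nlinarith
  rw [mul_div_assoc]
  linarith

lemma crs_le {p : ℕ} (θ x : Fin p → ℝ) (ε : ℝ) (hε : 0 ≤ ε) :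
    |crs θ x / (sqn x + ε)| ≤ 1 + sqn θ / 2 + 1 / (sqn x + ε) / 2 := by
  have hs := sqn_nonneg x
  have ht := sqn_nonneg θ
  rcases (add_nonneg hs hε).eq_or_lt with h | h
  · rw [← h]; simp; positivity
  have e : crs θ x = sqn x - ∑ i, θ i * x i := by
    simp only [crs, sqn, ← Finset.sum_sub_distrib]
    exact Finset.sum_congr rfl fun _ _ => by ring
  have cs : (∑ i, θ i * x i) ^ 2 ≤ sqn θ * sqn x := Finset.sum_mul_sq_le_sq_mul_sq _ _ _
  have h2 : |∑ i, θ i * x i| ≤ sqn θ / 2 * (sqn x + ε) + 1 / 2 := by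
    apply abs_le_of_sq_le_sq _ (by positivity)
    nlinarith [sq_nonneg (sqn θ / 2 * (sqn x + ε) - 1 / 2), mul_nonneg ht hε]
  rw [abs_div, abs_of_pos h, div_le_iff₀ h, e]
  have : (1 + sqn θ / 2 + 1 / (sqn x + ε) / 2) * (sqn x + ε) =
    (sqn x + ε) + sqn θ / 2 * (sqn x + ε) + 1 / 2 := by field_simp
  rw [this]
  refine (abs_sub _ _).trans ?_
  rw [abs_of_nonneg hs]
  linarith

lemma unif_bd {p : ℕ} (hp : 3 ≤ p) (θ : Fin p → ℝ) (ε : ℝ) (hε : 0 < ε) :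
    ∫ x, 1 / (sqn x + ε) ∂(gaussPi p θ) ≤ 2 + sqn θ := by
  have h1 := stein_ineq θ ε hε
  have h2 : ∫ x, crs θ x / (sqn x + ε) ∂(gaussPi p θ) ≤
      ∫ x, (1 + sqn θ / 2 + 1 / (sqn x + ε) / 2) ∂(gaussPi p θ) :=
    integral_mono (int_D θ ε hε) ((integrable_const _).add ((int_C θ ε hε).div_const _))
      fun x => (le_abs_self _).trans (crs_le θ x ε hε.le)
  rw [integral_add (integrable_const _) ((int_C θ ε hε).div_const _), integral_div] at h2
  simp only [integral_const, probReal_univ, one_smul] at h2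
  have h3 : 0 ≤ ∫ x, 1 / (sqn x + ε) ∂(gaussPi p θ) := integral_nonneg fun x => by
    have := sqn_nonneg x
    positivity
  have : (3 : ℝ) ≤ p := by exact_mod_cast hp
  nlinarith

lemma ae_pos {p : ℕ} (hp : 3 ≤ p) (θ : Fin p → ℝ) : ∀ᵐ x ∂(gaussPi p θ), 0 < sqn x := by
  have h : ∀ᵐ t ∂(gaussianReal (θ ⟨0, by omega⟩) 1), t ≠ 0 := by
    have := nullSingletonClass_gaussianReal (μ := θ ⟨0, by omega⟩) (v := 1) one_ne_zero
    rw [ae_iff]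
    simp
  have h2 := (measurePreserving_eval (fun i => gaussianReal (θ i) 1)
    ⟨0, by omega⟩).quasiMeasurePreserving.ae h
  unfold gaussPi
  filter_upwards [h2] with x hx
  obtain ⟨c, hc, h⟩ := sqn_split x ⟨0, by omega⟩
  rw [h]
  simp only [Function.eval] at hx
  positivity

/-- regularization sequence -/
noncomputable def ep (n : ℕ) : ℝ := 1 / ((n : ℝ) + 1)
lemma ep_pos (n : ℕ) : 0 < ep n := by unfold ep; positivity
lemma ep_lim : Filter.Tendsto ep Filter.atTop (nhds 0) := tendsto_one_div_add_atTop_nhds_zero_nat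

lemma lim_div (c s : ℝ) (hs : 0 < s) :
    Filter.Tendsto (fun n => c / (s + ep n)) Filter.atTop (nhds (c / s)) := by
  have := (tendsto_const_nhds (x := s)).add ep_lim
  rw [add_zero] at this
  exact tendsto_const_nhds.div this hs.ne'

lemma int_inv {p : ℕ} (hp : 3 ≤ p) (θ : Fin p → ℝ) :
    Integrable (fun x => 1 / sqn x) (gaussPi p θ) := by
  have hm := sqn_meas (p := p)
  refine ⟨Measurable.aestronglyMeasurable (by fun_prop), ?_⟩
  have hae : ∀ᵐ x ∂(gaussPi p θ), ‖1 / sqn x‖ₑ ≤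
      Filter.liminf (fun n => ENNReal.ofReal (1 / (sqn x + ep n))) Filter.atTop := by
    filter_upwards [ae_pos hp θ] with x hx
    have := (ENNReal.continuous_ofReal.tendsto _).comp (lim_div 1 (sqn x) hx)
    rw [Real.enorm_of_nonneg (by positivity)]
    exact this.liminf_eq.ge
  refine lt_of_le_of_lt ((lintegral_mono_ae hae).trans
    (lintegral_liminf_le fun n => by fun_prop)) ?_
  refine lt_of_le_of_lt (b := ENNReal.ofReal (2 + sqn θ)) ?_ ENNReal.ofReal_lt_top
  refine Filter.liminf_le_of_le (by isBoundedDefault) fun b hb => ?_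
  obtain ⟨n, hn⟩ := hb.exists
  refine hn.trans ?_
  rw [← ofReal_integral_eq_lintegral_ofReal (int_C θ _ (ep_pos n))]
  · exact ENNReal.ofReal_le_ofReal (unif_bd hp θ _ (ep_pos n))
  · refine Filter.Eventually.of_forall fun x => ?_
    have := sqn_nonneg x
    have := ep_pos n
    simp only [Pi.zero_apply]
    positivity

lemma int_crs {p : ℕ} (hp : 3 ≤ p) (θ : Fin p → ℝ) :
    Integrable (fun x => crs θ x / sqn x) (gaussPi p θ) := by
  have hm := sqn_meas (p := p)
  have hc : Measurable (crs θ) := by unfold crs; fun_prop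
  refine Integrable.mono' (((integrable_const (1 + sqn θ / 2)).add ((int_inv hp θ).div_const 2)))
    (Measurable.aestronglyMeasurable (by fun_prop)) (Filter.Eventually.of_forall fun x => ?_)
  have := crs_le θ x 0 le_rfl
  rw [add_zero] at this
  exact this

lemma stein_final {p : ℕ} (hp : 3 ≤ p) (θ : Fin p → ℝ) :
    ((p : ℝ) - 2) * ∫ x, 1 / sqn x ∂(gaussPi p θ) ≤ ∫ x, crs θ x / sqn x ∂(gaussPi p θ) := by
  have hm := sqn_meas (p := p)
  have hc : Measurable (crs θ) := by unfold crs; fun_prop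
  have hle : ∀ (n : ℕ) (x : Fin p → ℝ), 0 < sqn x → 1 / (sqn x + ep n) ≤ 1 / sqn x :=
    fun n x hx => one_div_le_one_div_of_le hx (by linarith [ep_pos n])
  have t1 : Filter.Tendsto (fun n => ∫ x, 1 / (sqn x + ep n) ∂(gaussPi p θ)) Filter.atTop
      (nhds (∫ x, 1 / sqn x ∂(gaussPi p θ))) := by
    refine tendsto_integral_of_dominated_convergence (fun x => 1 / sqn x)
      (fun n => Measurable.aestronglyMeasurable (by fun_prop)) (int_inv hp θ) (fun n => ?_) ?_
    · filter_upwards [ae_pos hp θ] with x hx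
      have := ep_pos n
      rw [Real.norm_of_nonneg (by positivity)]
      exact hle n x hx
    · filter_upwards [ae_pos hp θ] with x hx using lim_div _ _ hx
  have t2 : Filter.Tendsto (fun n => ∫ x, crs θ x / (sqn x + ep n) ∂(gaussPi p θ)) Filter.atTop
      (nhds (∫ x, crs θ x / sqn x ∂(gaussPi p θ))) := by
    refine tendsto_integral_of_dominated_convergence (fun x => 1 + sqn θ / 2 + 1 / sqn x / 2)
      (fun n => Measurable.aestronglyMeasurable (by fun_prop))
      ((integrable_const (1 + sqn θ / 2)).add ((int_inv hp θ).div_const 2)) (fun n => ?_) ?_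
    · filter_upwards [ae_pos hp θ] with x hx
      refine (crs_le θ x _ (ep_pos n).le).trans ?_
      linarith [hle n x hx]
    · filter_upwards [ae_pos hp θ] with x hx using lim_div _ _ hx
  exact le_of_tendsto_of_tendsto' (t1.const_mul _) t2 fun n => stein_ineq θ _ (ep_pos n)

lemma inv_pos_int {p : ℕ} (hp : 3 ≤ p) (θ : Fin p → ℝ) :
    0 < ∫ x, 1 / sqn x ∂(gaussPi p θ) := by
  have h0 : 0 ≤ fun x : Fin p → ℝ => 1 / sqn x := fun x => by
    have := sqn_nonneg x
    simp only [Pi.zero_apply]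
    positivity
  refine lt_of_le_of_ne (integral_nonneg h0) fun h => ?_
  have h' := (integral_eq_zero_iff_of_nonneg h0 (int_inv hp θ)).1 h.symm
  have : ∀ᵐ x ∂(gaussPi p θ), False := by
    filter_upwards [h', ae_pos hp θ] with x h1 h2
    simp at h1
    exact h2.ne' h1
  simp at this
  exact IsProbabilityMeasure.ne_zero _ this

lemma euclNorm_sq {p : ℕ} (x : Fin p → ℝ) : euclNorm x ^ 2 = sqn x :=
  Real.sq_sqrt (sqn_nonneg x)

lemma risk_pt {p : ℕ} (a : ℝ) (θ x : Fin p → ℝ) :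
    euclNorm (jsEst a x - θ) ^ 2 =
      euclNorm (x - θ) ^ 2 + (a ^ 2 * (1 / sqn x) - 2 * a * (crs θ x / sqn x)) := by
  simp only [euclNorm_sq, jsEst]
  split_ifs with h
  · subst h; simp [sqn]
  have hs : sqn x ≠ 0 := by
    intro h0
    apply h
    ext i
    obtain ⟨c, hc, h2⟩ := sqn_split x i
    rw [h0] at h2
    simp only [Pi.zero_apply]
    nlinarith [sq_nonneg (x i)]
  have e : sqn ((1 - a / sqn x) • x - θ) =
      sqn (x - θ) + ((a / sqn x) ^ 2 * sqn x - 2 * (a / sqn x) * crs θ x) := by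
    generalize a / sqn x = k
    simp only [sqn, crs, Finset.mul_sum, ← Finset.sum_sub_distrib, ← Finset.sum_add_distrib]
    refine Finset.sum_congr rfl fun i _ => ?_
    simp
    ring
  rw [e]
  field_simp

lemma int_sq {p : ℕ} (θ : Fin p → ℝ) :
    Integrable (fun x => euclNorm (x - θ) ^ 2) (gaussPi p θ) := by
  simp only [euclNorm_sq, sqn, Pi.sub_apply]
  exact integrable_finsetSum _ fun i _ =>
    integrable_comp_eval (μ := fun i => gaussianReal (θ i) 1) (gauss_int_sub_sq (θ i))

lemma js_strict (p : ℕ) (hp : 3 ≤ p) (a : ℝ) (ha : 0 < a) (ha2 : a < 2 * ((p : ℝ) - 2))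
    (θ : Fin p → ℝ) :
      ∫ x, (euclNorm (jsEst a x - θ)) ^ 2 ∂(gaussPi p θ) <
        ∫ x, (euclNorm (x - θ)) ^ 2 ∂(gaussPi p θ) := by
  simp_rw [risk_pt]
  have i1 := (int_inv hp θ).const_mul (a ^ 2)
  have i2 := (int_crs hp θ).const_mul (2 * a)
  have i3 : Integrable (fun x => a ^ 2 * (1 / sqn x) - 2 * a * (crs θ x / sqn x))
      (gaussPi p θ) := i1.sub i2
  rw [integral_add (int_sq θ) i3, integral_sub i1 i2, integral_const_mul,
    integral_const_mul]
  have h1 := stein_final hp θ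
  have h2 := inv_pos_int hp θ
  have h3 := mul_le_mul_of_nonneg_left h1 ha.le
  have h4 := mul_pos (mul_pos ha h2) (sub_pos.2 ha2)
  nlinarith

/-- James–Stein domination: for `p ≥ 3` and `0 < a < 2(p−2)`, the James–Stein estimator
dominates `X` in squared-error risk. -/
theorem stmt5 (p : ℕ) (hp : 3 ≤ p) (a : ℝ) (ha : 0 < a) (ha2 : a < 2 * ((p : ℝ) - 2)) :
    (∀ θ : Fin p → ℝ,
      ∫ x, (euclNorm (jsEst a x - θ)) ^ 2 ∂(gaussPi p θ) ≤
        ∫ x, (euclNorm (x - θ)) ^ 2 ∂(gaussPi p θ)) ∧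
    (∃ θ : Fin p → ℝ,
      ∫ x, (euclNorm (jsEst a x - θ)) ^ 2 ∂(gaussPi p θ) <
        ∫ x, (euclNorm (x - θ)) ^ 2 ∂(gaussPi p θ)) := by
  exact ⟨fun θ => (js_strict p hp a ha ha2 θ).le, 0, js_strict p hp a ha ha2 0⟩
end

section
/- For every a > 0, c > 0, and every unit vector u ∈ ℝ^p, the coverage probability of the recentered set converges to that of the usual set as the mean moves to infinity: lim_{t → ∞} P_{tu}({x : |tu − δ⁺_a(x)| ≤ c}) = P(|Z| ≤ c), where Z ~ N(0, I_p). -/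
open MeasureTheory ProbabilityTheory

open Filter Topology

lemma aux_cont {p : ℕ} : Continuous (euclNorm : (Fin p → ℝ) → ℝ) := by
  unfold euclNorm; fun_prop

lemma aux_js {p : ℕ} (a : ℝ) (x : Fin p → ℝ) :
    jsPlus a x = (max 0 (1 - a / (euclNorm x) ^ 2)) • x := by
  unfold jsPlus
  split_ifs with h
  · simp [h]
  · rfl

lemma aux_meas {p : ℕ} (a : ℝ) : Measurable (jsPlus (p := p) a) := by
  have h : jsPlus (p := p) a = fun x => (max 0 (1 - a / (euclNorm x) ^ 2)) • x :=
    funext (aux_js a)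
  rw [h]
  have := (aux_cont (p := p)).measurable
  fun_prop

lemma aux_coord {p : ℕ} (x : Fin p → ℝ) (i : Fin p) : |x i| ≤ euclNorm x := by
  unfold euclNorm
  apply Real.abs_le_sqrt
  exact Finset.single_le_sum (f := fun i => (x i) ^ 2) (fun j _ => sq_nonneg _) (Finset.mem_univ i)

lemma aux_sphere {p : ℕ} (hp : 1 ≤ p) (c : ℝ) : ∀ᵐ x ∂(gaussPi p 0), euclNorm x ≠ c := by
  obtain ⟨n, rfl⟩ : ∃ n, p = n + 1 := ⟨p - 1, by omega⟩
  have hS : MeasurableSet {x : Fin (n+1) → ℝ | euclNorm x = c} :=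
    measurableSet_eq_fun aux_cont.measurable measurable_const
  have mp := (measurePreserving_piFinSuccAbove
    (fun i : Fin (n+1) => gaussianReal ((0 : Fin (n+1) → ℝ) i) 1) 0).symm
  rw [ae_iff]
  simp only [ne_eq, not_not]
  unfold gaussPi
  rw [← mp.measure_preimage hS.nullMeasurableSet]
  rw [Measure.prod_apply_symm (mp.measurable hS)]
  rw [lintegral_eq_zero_iff' (measurable_measure_prodMk_right (mp.measurable hS)).aemeasurable]
  refine Eventually.of_forall fun y => ?_
  have hna := noAtoms_gaussianReal (μ := (0 : Fin (n+1) → ℝ) 0) (v := 1) one_ne_zero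
  refine Set.Finite.measure_zero ?_ _
  have hfin : ({Real.sqrt (c ^ 2 - ∑ i, y i ^ 2), -Real.sqrt (c ^ 2 - ∑ i, y i ^ 2)} : Set ℝ).Finite :=
    Set.toFinite _
  refine hfin.subset ?_
  intro x hx
  have hx' : Real.sqrt (∑ i, (Fin.insertNth (α := fun _ => ℝ) 0 x y i) ^ 2) = c := hx
  rw [Fin.sum_univ_succ] at hx'
  simp only [Fin.insertNth_zero', Fin.cons_zero, Fin.cons_succ] at hx'
  have h2 : x ^ 2 = c ^ 2 - ∑ i, y i ^ 2 := by
    rw [← hx', Real.sq_sqrt (by positivity)]; ring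
  rw [← h2, Real.sqrt_sq_eq_abs]
  rcases abs_choice x with h | h <;> simp [h]

lemma aux_map {p : ℕ} (θ : Fin p → ℝ) :
    gaussPi p θ = (gaussPi p 0).map (fun z => z + θ) := by
  unfold gaussPi
  have := Measure.pi_map_pi (μ := fun i : Fin p => gaussianReal ((0 : Fin p → ℝ) i) 1)
    (f := fun i x => x + θ i) (fun i => by fun_prop)
  simp only [gaussianReal_map_add_const] at this
  simp only [Pi.zero_apply, zero_add] at this ⊢
  rw [← this]
  rfl

lemma aux_lim {p : ℕ} (a : ℝ) (ha : 0 < a) (u : Fin p → ℝ) (hu : euclNorm u = 1)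
    (z : Fin p → ℝ) :
    Tendsto (fun t : ℝ => t • u - jsPlus a (z + t • u)) atTop (𝓝 (-z)) := by
  obtain ⟨j, hj⟩ : ∃ j, u j ≠ 0 := by
    by_contra! h
    simp [euclNorm, h] at hu
  have hN : Tendsto (fun t : ℝ => euclNorm (z + t • u)) atTop atTop := by
    have h1 : Tendsto (fun t : ℝ => t * |u j| - |z j|) atTop atTop :=
      tendsto_atTop_add_const_right _ _ (tendsto_id.atTop_mul_const (abs_pos.mpr hj))
    refine tendsto_atTop_mono' _ ?_ h1
    filter_upwards [eventually_ge_atTop 0] with t ht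
    refine le_trans ?_ (aux_coord _ j)
    have h2 := abs_sub_abs_le_abs_sub (t * u j) (-(z j))
    rw [abs_mul, abs_of_nonneg ht, abs_neg] at h2
    simpa [add_comm] using h2
  rw [tendsto_pi_nhds]
  intro i
  have h0 : Tendsto (fun t : ℝ => a / (euclNorm (z + t • u))^2 * (z + t • u) i) atTop (𝓝 0) := by
    apply squeeze_zero_norm' _ (hN.const_div_atTop a)
    filter_upwards [hN.eventually_gt_atTop 0] with t ht
    rw [Real.norm_eq_abs, abs_mul, abs_of_nonneg (by positivity)]
    calc _ ≤ a / (euclNorm (z + t • u))^2 * euclNorm (z + t • u) := by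
          gcongr; exact aux_coord _ i
      _ = _ := by field_simp
  have h3 := h0.const_add (-(z i))
  rw [add_zero] at h3
  refine h3.congr' ?_
  filter_upwards [hN.eventually_gt_atTop 0, hN.eventually_ge_atTop (a+1)] with t ht ht'
  have : a / (euclNorm (z + t • u))^2 ≤ 1 := by
    rw [div_le_one (by positivity)]
    nlinarith
  rw [aux_js, max_eq_right (by linarith)]
  simp only [Pi.sub_apply, Pi.smul_apply, Pi.add_apply, smul_eq_mul]
  ring

/-- As the mean moves to infinity along a unit vector, the coverage probability of the
recentered positive-part set converges to `P(|Z| ≤ c)` for `Z ~ N(0, I_p)`. -/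
theorem stmt8 (p : ℕ) (hp : 1 ≤ p) (a c : ℝ) (ha : 0 < a) (hc : 0 < c)
    (u : Fin p → ℝ) (hu : euclNorm u = 1) :
    Filter.Tendsto
      (fun t : ℝ => gaussPi p (t • u) {x : Fin p → ℝ | euclNorm (t • u - jsPlus a x) ≤ c})
      Filter.atTop
      (nhds (gaussPi p 0 {x : Fin p → ℝ | euclNorm x ≤ c})) := by
  have hm : ∀ t : ℝ, MeasurableSet {x : Fin p → ℝ | euclNorm (t • u - jsPlus a x) ≤ c} := by
    intro t
    have h1 := (aux_cont (p := p)).measurable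
    have h2 := aux_meas (p := p) a
    exact measurableSet_le (h1.comp (measurable_const.sub h2)) measurable_const
  have hadd : ∀ t : ℝ, Measurable (fun z : Fin p → ℝ => z + t • u) := fun t => by fun_prop
  have heq : ∀ t : ℝ, gaussPi p (t • u) {x : Fin p → ℝ | euclNorm (t • u - jsPlus a x) ≤ c}
      = gaussPi p 0 {z : Fin p → ℝ | euclNorm (t • u - jsPlus a (z + t • u)) ≤ c} := by
    intro t
    rw [aux_map, Measure.map_apply (hadd t) (hm t)]
    rfl
  simp only [heq]
  haveI : IsProbabilityMeasure (gaussPi p 0) := by unfold gaussPi; infer_instance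
  apply tendsto_measure_of_ae_tendsto_indicator_of_isFiniteMeasure (μ := gaussPi p 0) atTop
  · exact measurableSet_le (aux_cont (p := p)).measurable measurable_const
  · intro t
    exact hadd t (hm t)
  · filter_upwards [aux_sphere hp c] with z hz
    have hl := (aux_cont.tendsto (-z)).comp (aux_lim a ha u hu z)
    have hneg : euclNorm (-z) = euclNorm z := by simp [euclNorm]
    rw [hneg] at hl
    rcases lt_or_gt_of_ne hz with h | h
    · filter_upwards [hl.eventually_lt_const h] with t ht
      exact iff_of_true ht.le h.le
    · filter_upwards [hl.eventually_const_lt h] with t ht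
      exact iff_of_false (not_le.mpr ht) (not_le.mpr h)
end

section
/- Let p ≥ 1, τ > 0, c > 0, and set M = τ²/(τ² + 1). The Bayesian highest posterior density region C^π_x = {θ : |θ − Mx| ≤ c√M} fails to maintain frequentist coverage: there exists θ ∈ ℝ^p such that P_θ({x : |θ − Mx| ≤ c√M}) < P(|Z| ≤ c), where Z ~ N(0, I_p). -/
open MeasureTheory ProbabilityTheory

/-- The Bayesian HPD region `{θ : |θ − Mx| ≤ c√M}` with `M = τ²/(τ²+1)` fails to maintain
frequentist coverage: some `θ` has coverage probability below `P(|Z| ≤ c)`, `Z ~ N(0, I_p)`. -/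
theorem stmt10 (p : ℕ) (hp : 1 ≤ p) (τ c : ℝ) (hτ : 0 < τ) (hc : 0 < c)
    (M : ℝ) (hM : M = τ ^ 2 / (τ ^ 2 + 1)) :
    ∃ θ : Fin p → ℝ,
      gaussPi p θ {x : Fin p → ℝ | euclNorm (θ - M • x) ≤ c * Real.sqrt M} <
        gaussPi p 0 {x : Fin p → ℝ | euclNorm x ≤ c} := by
  have hM0 : 0 < M := by rw [hM]; positivity
  have hM1 : 0 < 1 - M := by
    have : 1 - M = 1 / (τ ^ 2 + 1) := by rw [hM]; field_simp; ring
    rw [this]; positivity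
  have hpR : (1 : ℝ) ≤ p := by exact_mod_cast hp
  -- positivity of the right-hand side
  have hpos : 0 < gaussPi p 0 {x : Fin p → ℝ | euclNorm x ≤ c} := by
    have hsub : (Set.univ.pi fun _ : Fin p => Set.Ioo (-(c / p)) (c / p)) ⊆
        {x : Fin p → ℝ | euclNorm x ≤ c} := by
      intro x hx
      have hx' : ∀ i, (x i) ^ 2 ≤ (c / p) ^ 2 := by
        intro i
        have h := hx i (Set.mem_univ i)
        exact sq_le_sq' h.1.le h.2.le
      show Real.sqrt _ ≤ c
      refine Real.sqrt_le_iff.mpr ⟨hc.le, ?_⟩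
      calc ∑ i, (x i) ^ 2 ≤ ∑ _i : Fin p, (c / p) ^ 2 := Finset.sum_le_sum fun i _ => hx' i
        _ = c ^ 2 / p := by
          rw [Finset.sum_const, Finset.card_univ, Fintype.card_fin, nsmul_eq_mul]
          field_simp
        _ ≤ c ^ 2 := div_le_self (sq_nonneg c) hpR
    refine lt_of_lt_of_le ?_ (measure_mono hsub)
    rw [gaussPi, Measure.pi_pi]
    refine pos_iff_ne_zero.mpr (Finset.prod_ne_zero_iff.mpr fun i _ => ?_)
    intro h0
    have hv := gaussianReal_absolutelyContinuous' ((0 : Fin p → ℝ) i) (one_ne_zero) h0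
    rw [Real.volume_Ioo, ENNReal.ofReal_eq_zero] at hv
    have : 0 < c / p := by positivity
    linarith
  -- tails
  have htail : Filter.Tendsto (fun s : ℝ => gaussianReal 0 1 (Set.Ici s)) Filter.atTop (nhds 0) := by
    have h := tendsto_measure_iInter_atTop (μ := gaussianReal 0 1) (s := fun s : ℝ => Set.Ici s)
      (fun s => measurableSet_Ici.nullMeasurableSet)
      (fun a b hab => Set.Ici_subset_Ici.mpr hab) ⟨0, measure_ne_top _ _⟩
    have he : (⋂ s : ℝ, Set.Ici s) = ∅ := by
      ext x
      simp only [Set.mem_iInter, Set.mem_Ici, Set.mem_empty_iff_false, iff_false, not_forall]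
      exact ⟨x + 1, by linarith⟩
    rwa [he, measure_empty] at h
  obtain ⟨s, hs⟩ := (htail.eventually_lt_const hpos).exists
  -- choose t with (t - c√M)/M - t = s
  set t : ℝ := (s * M + c * Real.sqrt M) / (1 - M) with ht
  have ht' : t * (1 - M) = s * M + c * Real.sqrt M := by
    rw [ht]; field_simp
  refine ⟨fun _ => t, lt_of_le_of_lt ?_ hs⟩
  let i0 : Fin p := ⟨0, hp⟩
  have hsub : {x : Fin p → ℝ | euclNorm ((fun _ => t) - M • x) ≤ c * Real.sqrt M} ⊆
      Function.eval i0 ⁻¹' Set.Ici (s + t) := by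
    intro x hx
    have h1 : (t - M * x i0) ^ 2 ≤ ∑ i, (((fun _ => t) - M • x : Fin p → ℝ) i) ^ 2 := by
      have := Finset.single_le_sum (f := fun i => (((fun _ => t) - M • x : Fin p → ℝ) i) ^ 2)
        (fun i _ => sq_nonneg _) (Finset.mem_univ i0)
      simpa using this
    have h2 : t - M * x i0 ≤ c * Real.sqrt M := (Real.le_sqrt_of_sq_le h1).trans hx
    show s + t ≤ x i0
    have h3 : M * (s + t) ≤ M * x i0 := by linarith
    exact le_of_mul_le_mul_left h3 hM0
  refine (measure_mono hsub).trans (le_of_eq ?_)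
  rw [gaussPi, (measurePreserving_eval (fun _ : Fin p => gaussianReal t 1) i0).measure_preimage
    measurableSet_Ici.nullMeasurableSet]
  have hmap := gaussianReal_map_add_const (μ := 0) (v := 1) t
  rw [zero_add] at hmap
  rw [← hmap, Measure.map_apply (by fun_prop) measurableSet_Ici]
  congr 1
  ext x
  simp
end

section
/- Let p ≥ 3 be an integer and c > 1. Then ν(x) < c² for all x ∈ ℝ^p; consequently He's empirical Bayes interval δ⁺_i(x) ± √(ν(x)) is strictly shorter than the usual interval x_i ± c in every coordinate. -/
/-- He's (1992) truncated shrinkage factor `M̂`. -/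
noncomputable def Mhat (p : ℕ) (x : Fin p → ℝ) : ℝ :=
  if x = 0 then 1 / ((p : ℝ) - 1)
  else max (max 0 (1 - ((p : ℝ) - 2) / (euclNorm x) ^ 2)) (1 / ((p : ℝ) - 1))

/-- He's (1992) radius-squared function `ν(x) = M̂(x)(c² − log M̂(x))`. -/
noncomputable def nuHe (p : ℕ) (c : ℝ) (x : Fin p → ℝ) : ℝ :=
  Mhat p x * (c ^ 2 - Real.log (Mhat p x))

theorem euclNorm_sq_pos {p : ℕ} (x : Fin p → ℝ) (hx : x ≠ 0) : 0 < (euclNorm x) ^ 2 := by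
  unfold euclNorm
  obtain ⟨i, hi⟩ := Function.ne_iff.mp hx
  have h : 0 < ∑ i, (x i) ^ 2 :=
    Finset.sum_pos' (fun j _ => sq_nonneg _) ⟨i, Finset.mem_univ i, by simpa using sq_pos_of_ne_zero hi⟩
  rw [Real.sq_sqrt h.le]
  exact h

theorem Mhat_mem (p : ℕ) (hp : 3 ≤ p) (x : Fin p → ℝ) : 0 < Mhat p x ∧ Mhat p x < 1 := by
  have hp' : (3 : ℝ) ≤ p := by exact_mod_cast hp
  have h1 : 0 < 1 / ((p : ℝ) - 1) := by
    apply one_div_pos.mpr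
    linarith
  have h2 : 1 / ((p : ℝ) - 1) < 1 := by
    rw [div_lt_one (by linarith)]
    linarith
  unfold Mhat
  split_ifs with hx
  · exact ⟨h1, h2⟩
  · refine ⟨lt_max_of_lt_right h1, max_lt (max_lt one_pos ?_) h2⟩
    have : 0 < ((p : ℝ) - 2) / (euclNorm x) ^ 2 :=
      div_pos (by linarith) (euclNorm_sq_pos x hx)
    linarith

/-- For `p ≥ 3` and `c > 1`, He's radius-squared function satisfies `ν(x) < c²` everywhere;
consequently the half-length `√(ν(x))` of He's empirical Bayes interval is strictly smaller
than the half-length `c` of the usual interval. -/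
theorem stmt14 (p : ℕ) (hp : 3 ≤ p) (c : ℝ) (hc : 1 < c) (x : Fin p → ℝ) :
    nuHe p c x < c ^ 2 ∧ Real.sqrt (nuHe p c x) < c := by
  obtain ⟨h0, h1⟩ := Mhat_mem p hp x
  have key : nuHe p c x < c ^ 2 := by
    unfold nuHe
    generalize Mhat p x = M at h0 h1
    have hl := Real.one_sub_inv_le_log_of_pos h0
    have h2 : M * (1 - M⁻¹) ≤ M * Real.log M := mul_le_mul_of_nonneg_left hl h0.le
    have h3 : M * (1 - M⁻¹) = M - 1 := by
      field_simp
    have h4 : 1 < c ^ 2 := by nlinarith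
    nlinarith [mul_pos (sub_pos.mpr h1) (sub_pos.mpr h4)]
  exact ⟨key, (Real.sqrt_lt' (by linarith)).mpr key⟩
end

section
/- Stein's variance estimator uniformly dominates the best multiple of S²: for every μ ∈ ℝ and σ > 0, E[(δ^S − σ²)²/σ⁴] ≤ E[((S²/(n+1)) − σ²)²/σ⁴], and the inequality is strict for some (μ, σ). -/
open MeasureTheory ProbabilityTheory

/-- The joint distribution of `n` i.i.d. `N(μ, σ²)` observations. -/
noncomputable def iidNormal (n : ℕ) (μ σ : ℝ) : Measure (Fin n → ℝ) :=
  Measure.pi fun _ => gaussianReal μ (σ ^ 2).toNNReal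

/-- Sample mean `X̄ = (1/n) ∑ Xᵢ`. -/
noncomputable def xbar (n : ℕ) (x : Fin n → ℝ) : ℝ := (∑ i, x i) / n

/-- Sum of squared deviations `S² = ∑ (Xᵢ − X̄)²`. -/
noncomputable def S2 (n : ℕ) (x : Fin n → ℝ) : ℝ := ∑ i, (x i - xbar n x) ^ 2

/-- Stein's truncation function `h(w) = min{1/(n+1), (1 + n w)/(n+2)}`. -/
noncomputable def steinH (n : ℕ) (w : ℝ) : ℝ :=
  min (1 / ((n : ℝ) + 1)) ((1 + (n : ℝ) * w) / ((n : ℝ) + 2))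

/-- Stein's variance estimator `δ^S = h(X̄²/S²) S²`. -/
noncomputable def deltaS (n : ℕ) (x : Fin n → ℝ) : ℝ :=
  steinH n ((xbar n x) ^ 2 / S2 n x) * S2 n x

namespace Stein

/-- sum of squares -/
noncomputable def Q (n : ℕ) (x : Fin n → ℝ) : ℝ := ∑ i, x i ^ 2

/-- the gain of the Stein estimator -/
noncomputable def gain (n : ℕ) (x : Fin n → ℝ) : ℝ :=
  max 0 (S2 n x / ((n : ℝ) + 1) - Q n x / ((n : ℝ) + 2))

/-- symmetrised gaussian weight -/
noncomputable def wt (n : ℕ) (μ v : ℝ) (x : Fin n → ℝ) : ℝ :=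
  Real.exp (-Q n x / (2 * v)) * Real.cosh (μ * (∑ i, x i) / v)

lemma S2_nonneg (n : ℕ) (x : Fin n → ℝ) : 0 ≤ S2 n x :=
  Finset.sum_nonneg fun _ _ => sq_nonneg _

lemma Q_nonneg (n : ℕ) (x : Fin n → ℝ) : 0 ≤ Q n x :=
  Finset.sum_nonneg fun _ _ => sq_nonneg _

lemma Q_eq (n : ℕ) (hn : 2 ≤ n) (x : Fin n → ℝ) : Q n x = S2 n x + n * xbar n x ^ 2 := by
  have hn0 : (n : ℝ) ≠ 0 := by positivity
  have hs : ∑ i, x i = n * xbar n x := by unfold xbar; field_simp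
  have h : S2 n x = ∑ i, (x i ^ 2 - 2 * xbar n x * x i + xbar n x ^ 2) := by
    unfold S2; exact Finset.sum_congr rfl fun i _ => by ring
  rw [h, Finset.sum_add_distrib, Finset.sum_sub_distrib, ← Finset.mul_sum, hs]
  simp [Q]; ring

lemma S2_le_Q (n : ℕ) (hn : 2 ≤ n) (x : Fin n → ℝ) : S2 n x ≤ Q n x := by
  rw [Q_eq n hn]; have := sq_nonneg (xbar n x); nlinarith [(Nat.cast_nonneg n : (0:ℝ) ≤ n)]

lemma gain_nonneg (n : ℕ) (x : Fin n → ℝ) : 0 ≤ gain n x := le_max_left _ _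

lemma gain_le (n : ℕ) (hn : 2 ≤ n) (x : Fin n → ℝ) : gain n x ≤ Q n x := by
  have h1 := S2_le_Q n hn x
  have h2 := S2_nonneg n x
  have h3 := Q_nonneg n x
  refine max_le h3 ?_
  have : S2 n x / ((n : ℝ) + 1) ≤ S2 n x := div_le_self h2 (by linarith [(Nat.cast_nonneg n : (0:ℝ) ≤ n)])
  have : 0 ≤ Q n x / ((n : ℝ) + 2) := by positivity
  linarith

lemma deltaS_eq (n : ℕ) (hn : 2 ≤ n) (x : Fin n → ℝ) :
    deltaS n x = S2 n x / ((n : ℝ) + 1) - gain n x := by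
  have h2 := S2_nonneg n x
  have h3 := Q_nonneg n x
  have hq : min (S2 n x / ((n : ℝ) + 1)) (Q n x / ((n : ℝ) + 2)) =
      S2 n x / ((n : ℝ) + 1) - gain n x := by
    unfold gain
    rcases le_total (S2 n x / ((n : ℝ) + 1)) (Q n x / ((n : ℝ) + 2)) with h | h
    · rw [min_eq_left h, max_eq_left (by linarith)]; ring
    · rw [min_eq_right h, max_eq_right (by linarith)]; ring
  rw [← hq]
  unfold deltaS steinH
  rcases h2.eq_or_lt with h | h
  · rw [← h, zero_div, mul_zero, min_eq_left (by positivity)]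
  · rw [min_mul_of_nonneg _ _ h2, Q_eq n hn]
    congr 1
    · ring
    · field_simp

lemma gain_mul (n : ℕ) (x : Fin n → ℝ) :
    gain n x * (S2 n x / ((n : ℝ) + 1)) = gain n x * (Q n x / ((n : ℝ) + 2)) + gain n x ^ 2 := by
  unfold gain
  rcases le_total (S2 n x / ((n : ℝ) + 1)) (Q n x / ((n : ℝ) + 2)) with h | h
  · rw [max_eq_left (by linarith)]; ring
  · rw [max_eq_right (by linarith)]; ring

lemma continuous_Q (n : ℕ) : Continuous (Q n) := by unfold Q; fun_prop
lemma continuous_S2 (n : ℕ) : Continuous (S2 n) := by unfold S2 xbar; fun_prop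
lemma continuous_gain (n : ℕ) : Continuous (gain n) := by
  have := continuous_Q n
  have := continuous_S2 n
  unfold gain; fun_prop
lemma continuous_wt (n : ℕ) (μ v : ℝ) : Continuous (wt n μ v) := by
  have := continuous_Q n
  unfold wt; fun_prop

lemma Q_smul (n : ℕ) (t : ℝ) (x : Fin n → ℝ) : Q n (t • x) = t ^ 2 * Q n x := by
  simp [Q, mul_pow, Finset.mul_sum]
lemma S2_smul (n : ℕ) (t : ℝ) (x : Fin n → ℝ) : S2 n (t • x) = t ^ 2 * S2 n x := by
  simp only [S2, xbar, Finset.mul_sum, Pi.smul_apply, smul_eq_mul, ← mul_pow]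
  refine Finset.sum_congr rfl fun i _ => ?_
  rw [← Finset.mul_sum]; ring
lemma gain_smul (n : ℕ) (t : ℝ) (x : Fin n → ℝ) : gain n (t • x) = t ^ 2 * gain n x := by
  unfold gain
  rw [Q_smul, S2_smul, mul_max_of_nonneg _ _ (sq_nonneg t), mul_zero]
  congr 1; ring
lemma Q_neg (n : ℕ) (x : Fin n → ℝ) : Q n (-x) = Q n x := by simp [Q]
lemma gain_neg (n : ℕ) (x : Fin n → ℝ) : gain n (-x) = gain n x := by
  have := gain_smul n (-1) x
  simpa using this

lemma iid_density (n : ℕ) (μ σ : ℝ) (hσ : 0 < σ) :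
    iidNormal n μ σ = (volume : Measure (Fin n → ℝ)).withDensity
      (fun x => ENNReal.ofReal (∏ i, gaussianPDFReal μ (σ ^ 2).toNNReal (x i))) := by
  have hv : (σ ^ 2).toNNReal ≠ 0 := by
    simp [hσ.ne']
  unfold iidNormal
  refine Measure.pi_eq fun s hs => ?_
  rw [withDensity_apply _ (MeasurableSet.univ_pi hs), volume_pi, Measure.restrict_pi_pi,
    ← ofReal_integral_eq_lintegral_ofReal]
  · rw [integral_fintype_prod_eq_prod, ENNReal.ofReal_prod_of_nonneg]
    · refine Finset.prod_congr rfl fun i _ => ?_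
      rw [gaussianReal_apply_eq_integral _ hv]
    · intro i _
      exact integral_nonneg fun x => gaussianPDFReal_nonneg _ _ _
  · exact Integrable.fintype_prod (f := fun _ => gaussianPDFReal μ (σ ^ 2).toNNReal)
      fun i => (integrable_gaussianPDFReal _ _).integrableOn
  · exact Filter.Eventually.of_forall fun x => Finset.prod_nonneg fun i _ => gaussianPDFReal_nonneg _ _ _

instance (n : ℕ) (μ σ : ℝ) : IsProbabilityMeasure (iidNormal n μ σ) := by
  unfold iidNormal; infer_instance

lemma integrable_of_bound (n : ℕ) (μ σ : ℝ) (g : (Fin n → ℝ) → ℝ) (hg : Continuous g) (C : ℝ)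
    (hC : ∀ x, |g x| ≤ C * (1 + Q n x ^ 2)) : Integrable g (iidNormal n μ σ) := by
  have h4 : ∀ i : Fin n, Integrable (fun x : Fin n → ℝ => x i ^ 4) (iidNormal n μ σ) := by
    intro i
    have h1 : MemLp id 4 (gaussianReal μ (σ ^ 2).toNNReal) := memLp_id_gaussianReal' 4 (by simp)
    have h2 : Integrable (fun y : ℝ => y ^ 4) (gaussianReal μ (σ ^ 2).toNNReal) := by
      have := h1.integrable_norm_pow (p := 4) (by norm_num)
      refine this.congr (Filter.Eventually.of_forall fun y => ?_)
      simp [Even.pow_abs (by decide : Even 4)]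
    exact (measurePreserving_eval (fun _ : Fin n => gaussianReal μ (σ ^ 2).toNNReal) i).integrable_comp_of_integrable h2
  have hQ : Integrable (fun x => Q n x ^ 2) (iidNormal n μ σ) := by
    refine Integrable.mono' (g := fun x => n * ∑ i, x i ^ 4)
      ((integrable_finsetSum _ fun i _ => h4 i).const_mul _)
      ((continuous_Q n).pow 2).aestronglyMeasurable (Filter.Eventually.of_forall fun x => ?_)
    rw [Real.norm_of_nonneg (sq_nonneg _)]
    have := sq_sum_le_card_mul_sum_sq (s := Finset.univ) (f := fun i : Fin n => x i ^ 2)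
    simpa [Q, ← pow_mul] using this
  exact Integrable.mono' (((integrable_const 1).add hQ).const_mul C) hg.aestronglyMeasurable
    (Filter.Eventually.of_forall fun x => hC x)

lemma pdf_symm (n : ℕ) (μ σ : ℝ) (hσ : 0 < σ) : ∃ c : ℝ, 0 < c ∧ ∀ x : Fin n → ℝ,
    (∏ i, gaussianPDFReal μ (σ ^ 2).toNNReal (x i)) +
      (∏ i, gaussianPDFReal μ (σ ^ 2).toNNReal ((-x) i)) = 2 * c * wt n μ (σ ^ 2) x := by
  have hv : ((σ ^ 2).toNNReal : ℝ) = σ ^ 2 := Real.coe_toNNReal _ (sq_nonneg _)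
  have hρ : ∀ x : Fin n → ℝ, ∏ i, gaussianPDFReal μ (σ ^ 2).toNNReal (x i) =
      (Real.sqrt (2 * Real.pi * σ ^ 2))⁻¹ ^ n * Real.exp (- n * μ ^ 2 / (2 * σ ^ 2)) *
       (Real.exp (-Q n x / (2 * σ ^ 2)) * Real.exp (μ * (∑ i, x i) / σ ^ 2)) := by
    intro x
    simp only [gaussianPDFReal, hv, Finset.prod_mul_distrib, Finset.prod_const, Finset.card_univ,
      Fintype.card_fin, ← Real.exp_sum]
    rw [mul_assoc ((Real.sqrt _)⁻¹ ^ n), ← Real.exp_add, ← Real.exp_add]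
    congr 2
    have h : ∑ i, -(x i - μ) ^ 2 / (2 * σ ^ 2)
        = ∑ i, (-(x i ^ 2) / (2 * σ ^ 2) + μ * x i / σ ^ 2 - μ ^ 2 / (2 * σ ^ 2)) :=
      Finset.sum_congr rfl fun i _ => by field_simp; ring
    rw [h, Finset.sum_sub_distrib, Finset.sum_add_distrib, ← Finset.sum_div, ← Finset.sum_div,
      ← Finset.mul_sum]
    simp [Q]; ring
  refine ⟨(Real.sqrt (2 * Real.pi * σ ^ 2))⁻¹ ^ n * Real.exp (- n * μ ^ 2 / (2 * σ ^ 2)),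
    by positivity, fun x => ?_⟩
  rw [hρ, hρ, Q_neg, wt, Real.cosh_eq]
  simp only [Pi.neg_apply, Finset.sum_neg_distrib, mul_neg, neg_div]
  ring

lemma transfer (n : ℕ) (μ σ : ℝ) (hσ : 0 < σ) : ∃ c : ℝ, 0 < c ∧ ∀ g : (Fin n → ℝ) → ℝ,
    (∀ x, g (-x) = g x) → Integrable g (iidNormal n μ σ) →
    Integrable (fun x => g x * wt n μ (σ ^ 2) x) ∧
    ∫ x, g x ∂(iidNormal n μ σ) = c * ∫ x, g x * wt n μ (σ ^ 2) x := by
  obtain ⟨c, hc, h⟩ := pdf_symm n μ σ hσ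
  refine ⟨c, hc, fun g hg hi => ?_⟩
  set ρ : (Fin n → ℝ) → ℝ := fun x => ∏ i, gaussianPDFReal μ (σ ^ 2).toNNReal (x i) with hρ
  have hρ0 : ∀ x, 0 ≤ ρ x := fun x => Finset.prod_nonneg fun i _ => gaussianPDFReal_nonneg _ _ _
  have hρm : Measurable ρ := Finset.measurable_prod _ fun i _ =>
    (measurable_gaussianPDFReal _ _).comp (measurable_pi_apply i)
  have hm : Measurable fun x => ENNReal.ofReal (ρ x) := hρm.ennreal_ofReal
  rw [iid_density n μ σ hσ] at hi ⊢
  have h1 : Integrable (fun x => ρ x * g x) := by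
    have := (integrable_withDensity_iff_integrable_smul' hm (by simp)).1 hi
    simpa [ENNReal.toReal_ofReal (hρ0 _)] using this
  have h2 : Integrable (fun x => ρ (-x) * g x) := by
    have := h1.comp_neg
    simpa [hg] using this
  have e : ∀ x, g x * wt n μ (σ ^ 2) x = (2 * c)⁻¹ * (ρ x * g x + ρ (-x) * g x) := by
    intro x
    rw [← add_mul, h x]; field_simp
  have e2 : ∫ x, ρ (-x) * g x = ∫ x, ρ x * g x := by
    rw [← integral_neg_eq_self (fun x => ρ x * g x)]; simp [hg]
  constructor
  · simp_rw [e]; exact (h1.add h2).const_mul _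
  · rw [integral_withDensity_eq_integral_toReal_smul hm (by simp)]
    simp_rw [e]
    rw [integral_const_mul, integral_add h1 h2, e2]
    simp only [ENNReal.toReal_ofReal (hρ0 _), smul_eq_mul]
    field_simp
    ring

lemma wt_ineq (n : ℕ) (μ v t : ℝ) (hv : 0 < v) (ht : 1 ≤ t) (x : Fin n → ℝ) :
    (1 - (t ^ 2 - 1) * Q n x / (2 * v)) * wt n μ v x ≤ wt n μ v (t • x) := by
  have h1 : Real.cosh (μ * (∑ i, x i) / v) ≤ Real.cosh (μ * (∑ i, (t • x) i) / v) := by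
    rw [Real.cosh_le_cosh]
    have : μ * (∑ i, (t • x) i) / v = t * (μ * (∑ i, x i) / v) := by
      simp only [Pi.smul_apply, smul_eq_mul, ← Finset.mul_sum]; ring
    rw [this, abs_mul, abs_of_nonneg (by linarith : 0 ≤ t)]
    exact le_mul_of_one_le_left (abs_nonneg _) ht
  have h2 : (1 - (t ^ 2 - 1) * Q n x / (2 * v)) * Real.exp (-Q n x / (2 * v)) ≤
      Real.exp (-Q n (t • x) / (2 * v)) := by
    have : -Q n (t • x) / (2 * v) = -((t ^ 2 - 1) * Q n x / (2 * v)) + -Q n x / (2 * v) := by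
      rw [Q_smul]; ring
    rw [this, Real.exp_add]
    refine mul_le_mul_of_nonneg_right ?_ (Real.exp_pos _).le
    linarith [Real.add_one_le_exp (-((t ^ 2 - 1) * Q n x / (2 * v)))]
  unfold wt
  rw [← mul_assoc]
  exact mul_le_mul h2 h1 (Real.cosh_pos _).le (Real.exp_pos _).le

lemma key (n : ℕ) (μ v : ℝ) (hv : 0 < v)
    (hG : Integrable (fun x => gain n x * wt n μ v x))
    (hA : Integrable (fun x => gain n x * Q n x * wt n μ v x)) :
    (n + 2) * v * ∫ x, gain n x * wt n μ v x ≤ ∫ x, gain n x * Q n x * wt n μ v x := by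
  set G := ∫ x, gain n x * wt n μ v x with hGdef
  set A := ∫ x, gain n x * Q n x * wt n μ v x with hAdef
  have hw : ∀ x, 0 ≤ wt n μ v x := fun x =>
    mul_nonneg (Real.exp_pos _).le (Real.cosh_pos _).le
  have hG0 : 0 ≤ G := integral_nonneg fun x => mul_nonneg (gain_nonneg _ _) (hw x)
  have step : ∀ t : ℝ, 1 ≤ t → t ^ (n + 2) * (G - (t ^ 2 - 1) / (2 * v) * A) ≤ G := by
    intro t ht
    have ht0 : 0 < t := by linarith
    have e : ∀ x, gain n x * wt n μ v (t • x) =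
        (t ^ 2)⁻¹ * (gain n (t • x) * wt n μ v (t • x)) := by
      intro x; rw [gain_smul]; field_simp
    have hi : Integrable (fun x => gain n x * wt n μ v (t • x)) := by
      simp_rw [e]
      exact (hG.comp_smul ht0.ne').const_mul _
    have hval : ∫ x, gain n x * wt n μ v (t • x) = (t ^ (n + 2))⁻¹ * G := by
      simp_rw [e]
      rw [integral_const_mul,
        Measure.integral_comp_smul volume (fun x => gain n x * wt n μ v x) t]
      simp only [Module.finrank_fin_fun, smul_eq_mul]
      rw [abs_of_pos (by positivity), pow_add, mul_inv]; ring
    have hle : G - (t ^ 2 - 1) / (2 * v) * A ≤ (t ^ (n + 2))⁻¹ * G := by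
      rw [← hval, hGdef, hAdef, ← integral_const_mul, ← integral_sub hG (hA.const_mul _)]
      refine integral_mono (hG.sub (hA.const_mul _)) hi fun x => ?_
      have := mul_le_mul_of_nonneg_left (wt_ineq n μ v t hv ht x) (gain_nonneg n x)
      refine le_trans (le_of_eq ?_) this
      simp only []
      ring
    calc _ ≤ t ^ (n + 2) * ((t ^ (n + 2))⁻¹ * G) := by gcongr
      _ = G := by field_simp
  have step2 : ∀ e : ℝ, 0 < e →
      (n + 2) * G ≤ (1 + e / 2) * (A / v) * (1 + (n + 2) * e) := by
    intro e he
    have h1 := step (1 + e) (by linarith)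
    have hb : 1 + ((n : ℝ) + 2) * e ≤ (1 + e) ^ (n + 2) := by
      have := one_add_mul_le_pow (a := e) (by linarith) (n + 2)
      push_cast at this; exact this
    have h2 : (1 + (n + 2) * e) * (G - ((1 + e) ^ 2 - 1) / (2 * v) * A) ≤ G := by
      rcases le_total 0 (G - ((1 + e) ^ 2 - 1) / (2 * v) * A) with h | h
      · exact (mul_le_mul_of_nonneg_right hb h).trans h1
      · exact (mul_nonpos_of_nonneg_of_nonpos (by positivity) h).trans hG0
    have h3 : ((1 + e) ^ 2 - 1) / (2 * v) * A = e * ((1 + e / 2) * (A / v)) := by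
      field_simp; ring
    rw [h3] at h2
    have h4 : e * ((n + 2) * G) ≤ e * ((1 + e / 2) * (A / v) * (1 + (n + 2) * e)) := by
      linarith
    exact le_of_mul_le_mul_left h4 he
  have lim : Filter.Tendsto (fun e : ℝ => (1 + e / 2) * (A / v) * (1 + (n + 2) * e))
      (nhdsWithin 0 (Set.Ioi 0)) (nhds (A / v)) := by
    have : Continuous (fun e : ℝ => (1 + e / 2) * (A / v) * (1 + ((n : ℝ) + 2) * e)) := by fun_prop
    have := (this.tendsto 0).mono_left (nhdsWithin_le_nhds (s := Set.Ioi 0))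
    simpa using this
  have hfin : (n + 2) * G ≤ A / v := ge_of_tendsto lim
    (Filter.eventually_of_mem self_mem_nhdsWithin fun e he => step2 e he)
  rw [le_div_iff₀ hv] at hfin
  linarith

lemma gain_sq_pos (n : ℕ) (hn : 2 ≤ n) (μ σ : ℝ) (hσ : 0 < σ)
    (hi : Integrable (fun x => gain n x ^ 2) (iidNormal n μ σ)) :
    0 < ∫ x, gain n x ^ 2 ∂(iidNormal n μ σ) := by
  rw [integral_pos_iff_support_of_nonneg (fun x => sq_nonneg _) hi]
  have hac : (volume : Measure (Fin n → ℝ)) ≪ iidNormal n μ σ := by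
    rw [iid_density n μ σ hσ]
    refine withDensity_absolutelyContinuous' ?_ ?_
    · refine Measurable.aemeasurable (Measurable.ennreal_ofReal (Finset.measurable_prod _ fun i _ =>
        (measurable_gaussianPDFReal _ _).comp (measurable_pi_apply i)))
    · refine Filter.Eventually.of_forall fun x => ?_
      have : 0 < ∏ i, gaussianPDFReal μ (σ ^ 2).toNNReal (x i) :=
        Finset.prod_pos fun i _ => gaussianPDFReal_pos _ _ _ (by simp [hσ.ne'])
      simpa using this
  refine pos_iff_ne_zero.2 fun h0 => ?_
  have h1 := hac h0
  have ho : IsOpen (Function.support fun x : Fin n → ℝ => gain n x ^ 2) :=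
    ((continuous_gain n).pow 2).isOpen_support
  have he := (ho.measure_eq_zero_iff volume).1 h1
  let a : Fin n := ⟨0, by omega⟩
  let b : Fin n := ⟨1, by omega⟩
  have hab : a ≠ b := by simp [a, b]
  let y : Fin n → ℝ := Pi.single a 1 - Pi.single b 1
  have hx : xbar n y = 0 := by simp [xbar, y, Finset.sum_sub_distrib]
  have hQ : 0 < Q n y := by
    refine lt_of_lt_of_le ?_ (Finset.single_le_sum (f := fun i => y i ^ 2)
      (fun i _ => sq_nonneg _) (Finset.mem_univ a))
    simp [y, hab]
  have hS : S2 n y = Q n y := by rw [Q_eq n hn, hx]; ring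
  have hg : 0 < gain n y := by
    unfold gain
    rw [hS]
    refine lt_max_of_lt_right (sub_pos.2 ?_)
    exact div_lt_div_of_pos_left hQ (by positivity) (by linarith)
  have : y ∈ Function.support fun x : Fin n → ℝ => gain n x ^ 2 := by
    simp [hg.ne']
  rw [he] at this
  exact this

lemma strict (n : ℕ) (hn : 2 ≤ n) (μ σ : ℝ) (hσ : 0 < σ) :
    ∫ x, (deltaS n x - σ ^ 2) ^ 2 / σ ^ 4 ∂(iidNormal n μ σ) <
      ∫ x, (S2 n x / ((n : ℝ) + 1) - σ ^ 2) ^ 2 / σ ^ 4 ∂(iidNormal n μ σ) := by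
  have cg := continuous_gain n
  have cQ := continuous_Q n
  have cS := continuous_S2 n
  have g0 := gain_nonneg n
  have gQ := gain_le n hn
  have Q0 := Q_nonneg n
  have i1 : Integrable (gain n) (iidNormal n μ σ) :=
    integrable_of_bound n μ σ _ cg 1 fun x => by
      rw [abs_of_nonneg (g0 x)]; nlinarith [gQ x, Q0 x, sq_nonneg (Q n x - 1)]
  have i2 : Integrable (fun x => gain n x * Q n x) (iidNormal n μ σ) :=
    integrable_of_bound n μ σ _ (by fun_prop) 1 fun x => by
      rw [abs_of_nonneg (mul_nonneg (g0 x) (Q0 x))]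
      nlinarith [mul_le_mul_of_nonneg_right (gQ x) (Q0 x)]
  have i3 : Integrable (fun x => gain n x ^ 2) (iidNormal n μ σ) :=
    integrable_of_bound n μ σ _ (by fun_prop) 1 fun x => by
      rw [abs_of_nonneg (sq_nonneg _)]
      nlinarith [pow_le_pow_left₀ (g0 x) (gQ x) 2]
  have i4 : Integrable (fun x => (S2 n x / ((n : ℝ) + 1) - σ ^ 2) ^ 2 / σ ^ 4)
      (iidNormal n μ σ) := by
    refine Integrable.div_const ?_ _
    refine integrable_of_bound n μ σ _ (by fun_prop) (1 + σ ^ 4) fun x => ?_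
    rw [abs_of_nonneg (sq_nonneg _)]
    have hs : 0 ≤ S2 n x / ((n : ℝ) + 1) := div_nonneg (S2_nonneg n x) (by positivity)
    have hs' : S2 n x / ((n : ℝ) + 1) ≤ Q n x :=
      (div_le_self (S2_nonneg n x) (by linarith [(Nat.cast_nonneg n : (0:ℝ) ≤ n)])).trans
        (S2_le_Q n hn x)
    have := pow_le_pow_left₀ hs hs' 2
    have h1 : 0 ≤ S2 n x / ((n : ℝ) + 1) * σ ^ 2 := by positivity
    have h2 : 0 ≤ σ ^ 4 * Q n x ^ 2 := by positivity
    nlinarith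
  obtain ⟨c, hc, htr⟩ := transfer n μ σ hσ
  obtain ⟨j1, e1⟩ := htr _ (gain_neg n) i1
  obtain ⟨j2, e2⟩ := htr _ (fun x => by rw [gain_neg, Q_neg]) i2
  have hk := mul_le_mul_of_nonneg_left (key n μ (σ ^ 2) (by positivity) j1 j2) hc.le
  have hk' : (n + 2) * σ ^ 2 * ∫ x, gain n x ∂(iidNormal n μ σ) ≤
      ∫ x, gain n x * Q n x ∂(iidNormal n μ σ) := by
    rw [e1, e2]; linarith
  have hp := gain_sq_pos n hn μ σ hσ i3
  have e : ∀ x, (deltaS n x - σ ^ 2) ^ 2 / σ ^ 4 =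
      (S2 n x / ((n : ℝ) + 1) - σ ^ 2) ^ 2 / σ ^ 4 -
        (2 / (σ ^ 4 * (n + 2)) * (gain n x * Q n x - (n + 2) * σ ^ 2 * gain n x)
          + gain n x ^ 2 / σ ^ 4) := by
    intro x
    have h := gain_mul n x
    have h' : (deltaS n x - σ ^ 2) ^ 2 = (S2 n x / ((n : ℝ) + 1) - σ ^ 2) ^ 2
        - 2 * (gain n x * (S2 n x / ((n : ℝ) + 1))) + 2 * σ ^ 2 * gain n x + gain n x ^ 2 := by
      rw [deltaS_eq n hn]; ring
    rw [h', h]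
    field_simp
    ring
  have i5 : Integrable (fun x => gain n x * Q n x - (n + 2) * σ ^ 2 * gain n x)
    (iidNormal n μ σ) := i2.sub (i1.const_mul _)
  have i6 : Integrable (fun x => 2 / (σ ^ 4 * ((n : ℝ) + 2)) *
      (gain n x * Q n x - (n + 2) * σ ^ 2 * gain n x) + gain n x ^ 2 / σ ^ 4)
      (iidNormal n μ σ) := (i5.const_mul _).add (i3.div_const _)
  simp_rw [e]
  rw [integral_sub i4 i6,
    integral_add (i5.const_mul _) (i3.div_const _), integral_const_mul, integral_div, integral_div,
    integral_sub i2 (i1.const_mul _), integral_const_mul]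
  have p1 : 0 < (∫ x, gain n x ^ 2 ∂(iidNormal n μ σ)) / σ ^ 4 := by positivity
  have p2 : 0 ≤ 2 / (σ ^ 4 * ((n : ℝ) + 2)) * (∫ x, gain n x * Q n x ∂(iidNormal n μ σ) -
      (n + 2) * σ ^ 2 * ∫ x, gain n x ∂(iidNormal n μ σ)) :=
    mul_nonneg (by positivity) (by linarith)
  linarith

end Stein

/-- Stein (1964): `δ^S` uniformly dominates `S²/(n+1)` in scale-invariant squared-error risk,
with strict inequality for some `(μ, σ)`. -/
theorem stmt15 (n : ℕ) (hn : 2 ≤ n) :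
    (∀ μ : ℝ, ∀ σ : ℝ, 0 < σ →
      ∫ x, (deltaS n x - σ ^ 2) ^ 2 / σ ^ 4 ∂(iidNormal n μ σ) ≤
        ∫ x, (S2 n x / ((n : ℝ) + 1) - σ ^ 2) ^ 2 / σ ^ 4 ∂(iidNormal n μ σ)) ∧
    (∃ μ : ℝ, ∃ σ : ℝ, 0 < σ ∧
      ∫ x, (deltaS n x - σ ^ 2) ^ 2 / σ ^ 4 ∂(iidNormal n μ σ) <
        ∫ x, (S2 n x / ((n : ℝ) + 1) - σ ^ 2) ^ 2 / σ ^ 4 ∂(iidNormal n μ σ)) := by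
  exact ⟨fun μ σ hσ => (Stein.strict n hn μ σ hσ).le, 0, 1, one_pos, Stein.strict n hn 0 1 one_pos⟩
end
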